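/- Let d be a real number with 0 ≤ d < 1/2. Then the iterated integral ∫₀¹∫₀^{y₁}∫₀^{y₂}∫₀^{y₃}∫₀^{y₄} (y₁−y₂)^(−d)(y₁−y₃)^(−d)(y₃−y₄)^(−d)(y₂−y₅)^(−d)(y₄−y₅)^(−d) dy₅ dy₄ dy₃ dy₂ dy₁ equals (Γ(1−d)²/(1−d))·(Γ(4−5d)·Γ(2−2d)/(Γ(6−5d)·Γ(4−4d)))·₃F₂(d, 1−d, 2−2d; 2−d, 4−4d; 1). -/

import Mathlib

open Real

noncomputable def poch (a : ℝ) (k : ℕ) : ℝ := ∏ i ∈ Finset.range k, (a + i)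

noncomputable def F21 (a b c x : ℝ) : ℝ :=
  ∑' k : ℕ, poch a k * poch b k / (poch c k * (Nat.factorial k : ℝ)) * x ^ k

noncomputable def F32 (a b c e f : ℝ) : ℝ :=
  ∑' k : ℕ, poch a k * poch b k * poch c k / (poch e k * poch f k * (Nat.factorial k : ℝ))

noncomputable def F32x (a b c e f x : ℝ) : ℝ :=
  ∑' k : ℕ, poch a k * poch b k * poch c k / (poch e k * poch f k * (Nat.factorial k : ℝ)) * x ^ k

noncomputable def F43 (a b c g e f h : ℝ) : ℝ :=
  ∑' k : ℕ, poch a k * poch b k * poch c k * poch g k /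
    (poch e k * poch f k * poch h k * (Nat.factorial k : ℝ))

open MeasureTheory ENNReal

noncomputable def pp (a x : ℝ) : ℝ≥0∞ := if 0 < x then ENNReal.ofReal (x ^ a) else 0

@[fun_prop]
lemma pp_meas (a : ℝ) : Measurable (pp a) :=
  Measurable.ite measurableSet_Ioi (by fun_prop) (by fun_prop)

lemma pp_pos {a x : ℝ} (h : 0 < x) : pp a x = ENNReal.ofReal (x ^ a) := if_pos h
lemma pp_neg {a x : ℝ} (h : x ≤ 0) : pp a x = 0 := if_neg (not_lt.2 h)

lemma pp_mul (a b x : ℝ) : pp a x * pp b x = pp (a + b) x := by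
  by_cases h : 0 < x
  · rw [pp_pos h, pp_pos h, pp_pos h, ← ENNReal.ofReal_mul (by positivity), Real.rpow_add h]
  · simp [pp, h]

lemma lint_smul (s : ℝ) (hs : 0 < s) (f : ℝ → ℝ≥0∞) (hf : Measurable f) :
    ∫⁻ y, f y = ENNReal.ofReal s * ∫⁻ t, f (s * t) := by
  rw [← lintegral_map (f := f) (g := fun t => s * t) hf (by fun_prop)]
  conv_lhs => rw [← Real.smul_map_volume_mul_left hs.ne']
  rw [lintegral_smul_measure, abs_of_pos hs]
  rfl

lemma conv (a b x z : ℝ) (ha : -1 < a) (hb : -1 < b) :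
    ∫⁻ y, pp a (x - y) * pp b (y - z) =
      ENNReal.ofReal (ProbabilityTheory.beta (a + 1) (b + 1)) * pp (a + b + 1) (x - z) := by
  by_cases h : 0 < x - z
  swap
  · rw [pp_neg (not_lt.1 h), mul_zero, ← lintegral_zero (α := ℝ) (μ := volume)]
    congr 1; ext y
    by_cases h1 : 0 < x - y
    · rw [pp_neg (x := y - z) (by linarith), mul_zero]
    · rw [pp_neg (x := x - y) (by linarith), zero_mul]
  have hB := ProbabilityTheory.beta_pos (α := b+1) (β := a+1) (by linarith) (by linarith)
  have h1 := ProbabilityTheory.lintegral_betaPDF_eq_one (α := b+1) (β := a+1) (by linarith) (by linarith)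
  rw [← lintegral_add_left_eq_self _ z, lint_smul (x - z) h _ (by fun_prop)]
  have : ∀ t, pp a (x - (z + (x - z) * t)) * pp b (z + (x - z) * t - z) =
      ENNReal.ofReal (ProbabilityTheory.beta (b+1) (a+1) * (x-z) ^ (a+b)) *
       ProbabilityTheory.betaPDF (b+1) (a+1) t := by
    intro t
    rw [show x - (z + (x - z) * t) = (x - z) * (1 - t) by ring,
      show z + (x - z) * t - z = (x - z) * t by ring]
    rcases le_or_gt t 0 with ht | ht
    · rw [ProbabilityTheory.betaPDF_eq_zero_of_nonpos ht, pp_neg (x := (x-z)*t) (by nlinarith)]; simp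
    rcases le_or_gt 1 t with ht' | ht'
    · rw [ProbabilityTheory.betaPDF_eq_zero_of_one_le ht', pp_neg (x := (x-z)*(1-t)) (by nlinarith)]; simp
    have h2 : 0 < 1 - t := by linarith
    rw [ProbabilityTheory.betaPDF_of_pos_lt_one ht ht', pp_pos (by positivity), pp_pos (by positivity),
      ← ENNReal.ofReal_mul (by positivity), ← ENNReal.ofReal_mul (by positivity)]
    congr 1
    rw [Real.mul_rpow h.le h2.le, Real.mul_rpow h.le ht.le, Real.rpow_add h]
    simp only [add_sub_cancel_right]
    field_simp
  simp_rw [this]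
  rw [lintegral_const_mul' _ _ ENNReal.ofReal_ne_top, h1, mul_one, pp_pos h,
    ← ENNReal.ofReal_mul (by positivity), ← ENNReal.ofReal_mul]
  · congr 1
    rw [Real.rpow_add_one h.ne']
    have : ProbabilityTheory.beta (a+1) (b+1) = ProbabilityTheory.beta (b+1) (a+1) := by
      simp only [ProbabilityTheory.beta]; rw [add_comm (a+1), mul_comm (Gamma (a+1))]
    rw [this]; ring
  · exact (ProbabilityTheory.beta_pos (by linarith) (by linarith)).le

lemma step (b : ℝ) (hb : 0 ≤ b) (g : ℝ → ℝ) (G : ℝ → ℝ≥0∞) (hG : Measurable G)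
    (hs : ∀ y, y ∉ Set.Ioo 0 b → G y = 0)
    (h : ∀ y ∈ Set.Ioo 0 b, G y ≠ ∞ → g y = (G y).toReal) (hfin : ∫⁻ y, G y ≠ ∞) :
    ∫ y in (0:ℝ)..b, g y = (∫⁻ y, G y).toReal := by
  have e : ∫⁻ y, G y = ∫⁻ y in Set.Ioo 0 b, G y := by
    rw [← lintegral_indicator measurableSet_Ioo]
    congr 1; ext y
    by_cases hy : y ∈ Set.Ioo 0 b
    · simp [hy]
    · rw [Set.indicator_of_notMem hy, hs y hy]
  rw [intervalIntegral.integral_of_le hb, integral_Ioc_eq_integral_Ioo]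
  rw [e] at hfin ⊢
  have hae := ae_lt_top hG hfin
  rw [← integral_toReal hG.aemeasurable hae]
  apply integral_congr_ae
  filter_upwards [hae, ae_restrict_mem measurableSet_Ioo] with y hy hy'
  exact h y hy' hy.ne

lemma ml {α : Type*} [MeasurableSpace α] {f : α → ℝ → ℝ≥0∞}
    (hf : Measurable (fun q : α × ℝ => f q.1 q.2)) : Measurable fun a => ∫⁻ y, f a y :=
  hf.lintegral_prod_right'

lemma poch_nonneg {a : ℝ} (h : 0 ≤ a) (k : ℕ) : 0 ≤ poch a k :=
  Finset.prod_nonneg fun i _ => by positivity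
lemma poch_pos {a : ℝ} (h : 0 < a) (k : ℕ) : 0 < poch a k :=
  Finset.prod_pos fun i _ => by positivity
lemma poch_succ (a : ℝ) (k : ℕ) : poch a (k+1) = poch a k * (a + k) := Finset.prod_range_succ _ _

lemma poch_eq (a : ℝ) (k : ℕ) : poch a k = (ascPochhammer ℝ k).eval a := by
  induction k with
  | zero => simp [poch]
  | succ n ih => rw [poch_succ, ih, ascPochhammer_succ_eval]

lemma binom (a x : ℝ) (hx : 0 < x) (hx1 : x < 1) :
    HasSum (fun k : ℕ => poch a k / (Nat.factorial k : ℝ) * x ^ k) ((1 - x) ^ (-a)) := by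
  have := (Real.one_div_one_sub_rpow_hasFPowerSeriesOnBall_zero a).hasSum (y := x) (by
    simp [enorm_eq_nnnorm, ← NNReal.coe_lt_coe, abs_of_pos hx, hx1])
  have h1 : 0 < 1 - x := by linarith
  rw [zero_add, one_div, ← Real.rpow_neg h1.le] at this
  have key : ∀ k : ℕ, poch a k / (Nat.factorial k : ℝ) * x ^ k =
      (FormalMultilinearSeries.ofScalars ℝ (fun n : ℕ => Ring.choose (a + n - 1) n) k) fun _ => x := ?_
  · simp_rw [key]; exact this
  intro k
  rw [FormalMultilinearSeries.ofScalars_apply_eq, ← Ring.multichoose_eq]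
  have h2 := Ring.factorial_nsmul_multichoose_eq_ascPochhammer a k
  rw [Polynomial.ascPochhammer_smeval_eq_eval, ← poch_eq] at h2
  rw [← h2]
  rw [nsmul_eq_mul, smul_eq_mul]
  field_simp

lemma Gpoch {a : ℝ} (h : 0 < a) (k : ℕ) : Gamma (a + k) = poch a k * Gamma a := by
  induction k with
  | zero => simp [poch]
  | succ n ih =>
    rw [poch_succ, Nat.cast_succ, ← add_assoc, Real.Gamma_add_one (by positivity), ih]; ring

lemma expand (d x y z : ℝ) (h0 : 0 ≤ d) (h : z < y) :
    pp (-d) (x - y) * pp (-d) (y - z) =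
      ∑' k : ℕ, ENNReal.ofReal (poch d k / (Nat.factorial k : ℝ)) *
        (pp (-d + k) (x - y) * pp (-d - k) (x - z)) := by
  by_cases hw : 0 < x - y
  swap
  · simp [pp_neg (not_lt.1 hw)]
  have hs : 0 < x - z := by linarith
  have hyz : 0 < y - z := by linarith
  have hb := binom d ((x - y) / (x - z)) (by positivity) (by rw [div_lt_one hs]; linarith)
  have h1 : 1 - (x - y) / (x - z) = (y - z) / (x - z) := by field_simp; ring
  rw [h1] at hb
  have hb2 := hb.mul_left ((x - y) ^ (-d) * (x - z) ^ (-d))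
  rw [Real.div_rpow hyz.le hs.le, show (x - y) ^ (-d) * (x - z) ^ (-d) * ((y - z) ^ (-d) / (x - z) ^ (-d))
    = (x - y) ^ (-d) * (y - z) ^ (-d) by
      have : 0 < (x - z) ^ (-d) := by positivity
      field_simp] at hb2
  have hp := fun k => poch_nonneg h0 k
  rw [pp_pos hw, pp_pos hyz, ← ENNReal.ofReal_mul (by positivity), ← hb2.tsum_eq,
    ENNReal.ofReal_tsum_of_nonneg (fun k => by have := hp k; positivity) hb2.summable]
  congr 1; ext k
  have := hp k
  rw [pp_pos hw, pp_pos hs, ← ENNReal.ofReal_mul (by positivity), ← ENNReal.ofReal_mul (by positivity)]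
  congr 1
  rw [Real.rpow_add hw, Real.rpow_sub hs, Real.rpow_natCast, Real.rpow_natCast, div_pow]
  ring

noncomputable def FF (d y1 y2 y3 y4 y5 : ℝ) : ℝ≥0∞ :=
  pp 0 (1 - y1) * pp (-d) (y1 - y2) * pp (-d) (y1 - y3) * pp 0 (y2 - y3) * pp (-d) (y3 - y4) *
    pp (-d) (y2 - y5) * pp (-d) (y4 - y5) * pp 0 y5

lemma FF_zero (d y1 y2 y3 y4 y5 : ℝ)
    (h : ¬ (0 < y5 ∧ y5 < y4 ∧ y4 < y3 ∧ y3 < y2 ∧ y2 < y1 ∧ y1 < 1)) : FF d y1 y2 y3 y4 y5 = 0 := by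
  by_contra hne
  apply h
  simp only [FF, pp, mul_eq_zero, not_or, ite_eq_right_iff, Classical.not_imp] at hne
  obtain ⟨⟨⟨⟨⟨⟨⟨⟨a, _⟩, ⟨b, _⟩⟩, ⟨c, _⟩⟩, ⟨e, _⟩⟩, ⟨f, _⟩⟩, ⟨g, _⟩⟩, ⟨i, _⟩⟩, ⟨j, _⟩⟩ := hne
  refine ⟨?_, ?_, ?_, ?_, ?_, ?_⟩ <;> linarith

lemma real_side (d : ℝ) (hfin : ∫⁻ y1, ∫⁻ y2, ∫⁻ y3, ∫⁻ y4, ∫⁻ y5, FF d y1 y2 y3 y4 y5 ≠ ∞) :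
    (∫ y1 in (0:ℝ)..1, ∫ y2 in (0:ℝ)..y1, ∫ y3 in (0:ℝ)..y2, ∫ y4 in (0:ℝ)..y3, ∫ y5 in (0:ℝ)..y4,
      (y1 - y2) ^ (-d) * (y1 - y3) ^ (-d) * (y3 - y4) ^ (-d) * (y2 - y5) ^ (-d) * (y4 - y5) ^ (-d)) =
    (∫⁻ y1, ∫⁻ y2, ∫⁻ y3, ∫⁻ y4, ∫⁻ y5, FF d y1 y2 y3 y4 y5).toReal := by
  refine step _ zero_le_one _ _ ?_ ?_ ?_ hfin
  · unfold FF
    apply ml; apply ml; apply ml; apply ml; fun_prop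
  · intro y1 h1
    have : ∀ y2 y3 y4 y5, FF d y1 y2 y3 y4 y5 = 0 := fun y2 y3 y4 y5 =>
      FF_zero _ _ _ _ _ _ fun h => h1 ⟨by linarith, by linarith⟩
    simp [this]
  intro y1 h1 hfin
  refine step _ h1.1.le _ _ ?_ ?_ ?_ hfin
  · unfold FF
    apply ml; apply ml; apply ml; fun_prop
  · intro y2 h2
    have : ∀ y3 y4 y5, FF d y1 y2 y3 y4 y5 = 0 := fun y3 y4 y5 =>
      FF_zero _ _ _ _ _ _ fun h => h2 ⟨by linarith, by linarith⟩
    simp [this]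
  intro y2 h2 hfin
  refine step _ h2.1.le _ _ ?_ ?_ ?_ hfin
  · unfold FF
    apply ml; apply ml; fun_prop
  · intro y3 h3
    have : ∀ y4 y5, FF d y1 y2 y3 y4 y5 = 0 := fun y4 y5 =>
      FF_zero _ _ _ _ _ _ fun h => h3 ⟨by linarith, by linarith⟩
    simp [this]
  intro y3 h3 hfin
  refine step _ h3.1.le _ _ ?_ ?_ ?_ hfin
  · unfold FF
    apply ml; fun_prop
  · intro y4 h4
    have : ∀ y5, FF d y1 y2 y3 y4 y5 = 0 := fun y5 =>
      FF_zero _ _ _ _ _ _ fun h => h4 ⟨by linarith, by linarith⟩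
    simp [this]
  intro y4 h4 hfin
  refine step _ h4.1.le _ _ ?_ ?_ ?_ hfin
  · unfold FF; fun_prop
  · intro y5 h5
    exact FF_zero _ _ _ _ _ _ fun h => h5 ⟨by linarith, by linarith⟩
  intro y5 h5 hfin
  have a1 : 0 < 1 - y1 := by linarith [h1.2]
  have a2 : 0 < y1 - y2 := by linarith [h2.2]
  have a3 : 0 < y2 - y3 := by linarith [h3.2]
  have a4 : 0 < y3 - y4 := by linarith [h4.2]
  have a5 : 0 < y4 - y5 := by linarith [h5.2]
  have a6 : 0 < y1 - y3 := by linarith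
  have a7 : 0 < y2 - y5 := by linarith
  have a8 : 0 < y5 := h5.1
  rw [FF, pp_pos a1, pp_pos a2, pp_pos a3, pp_pos a4, pp_pos a5, pp_pos a6, pp_pos a7, pp_pos a8]
  simp only [Real.rpow_zero, ENNReal.ofReal_one, one_mul, mul_one, ENNReal.toReal_mul]
  rw [ENNReal.toReal_ofReal, ENNReal.toReal_ofReal, ENNReal.toReal_ofReal, ENNReal.toReal_ofReal,
    ENNReal.toReal_ofReal] <;> positivity

open ProbabilityTheory in
lemma inner_y2 (d : ℝ) (h0 : 0 ≤ d) (h1 : d < 1/2) (y1 y3 y5 : ℝ) :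
    ∫⁻ y2, pp (-d) (y1 - y2) * pp 0 (y2 - y3) * pp (-d) (y2 - y5) * pp (1 - 2 * d) (y3 - y5) =
    ∑' k : ℕ, ENNReal.ofReal (poch d k / (Nat.factorial k : ℝ)) * (pp (-d - k) (y1 - y5) *
      (ENNReal.ofReal (beta (1 - d + k) 1) * pp (1 - d + k) (y1 - y3) * pp (1 - 2 * d) (y3 - y5))) := by
  have : ∀ y2, pp (-d) (y1 - y2) * pp 0 (y2 - y3) * pp (-d) (y2 - y5) * pp (1 - 2 * d) (y3 - y5) =
      ∑' k : ℕ, (ENNReal.ofReal (poch d k / (Nat.factorial k : ℝ)) * pp (-d - k) (y1 - y5) *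
        pp (1 - 2 * d) (y3 - y5)) * (pp (-d + k) (y1 - y2) * pp 0 (y2 - y3)) := by
    intro y2
    by_cases ha : 0 < y3 - y5
    swap
    · simp [pp_neg (not_lt.1 ha)]
    by_cases hb : 0 < y2 - y3
    swap
    · simp [pp_neg (not_lt.1 hb)]
    calc _ = (pp (-d) (y1 - y2) * pp (-d) (y2 - y5)) * (pp 0 (y2 - y3) * pp (1 - 2 * d) (y3 - y5)) := by ring
      _ = _ := by
        rw [expand d _ _ _ h0 (by linarith), ← ENNReal.tsum_mul_right]
        congr 1; ext k; ring
  simp_rw [this]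
  rw [lintegral_tsum (fun k => by fun_prop)]
  congr 1; ext k
  rw [lintegral_const_mul _ (by fun_prop), conv _ _ _ _ (by
    have : (0:ℝ) ≤ k := by positivity
    linarith) (by norm_num)]
  rw [show -d + (k:ℝ) + 1 = 1 - d + k by ring, show -d + (k:ℝ) + 0 + 1 = 1 - d + k by ring, zero_add]
  ring

open ProbabilityTheory in
lemma inner_y3 (d : ℝ) (h0 : 0 ≤ d) (h1 : d < 1/2) (y1 y5 : ℝ) :
    ∫⁻ y3, pp (-d) (y1 - y3) * ∫⁻ y2,
      pp (-d) (y1 - y2) * pp 0 (y2 - y3) * pp (-d) (y2 - y5) * pp (1 - 2 * d) (y3 - y5) =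
    (∑' k : ℕ, ENNReal.ofReal (poch d k / (Nat.factorial k : ℝ)) *
      (ENNReal.ofReal (beta (1 - d + k) 1) * ENNReal.ofReal (beta (2 - 2 * d + k) (2 - 2 * d)))) *
      pp (3 - 5 * d) (y1 - y5) := by
  have : ∀ y3, pp (-d) (y1 - y3) * ∫⁻ y2,
      pp (-d) (y1 - y2) * pp 0 (y2 - y3) * pp (-d) (y2 - y5) * pp (1 - 2 * d) (y3 - y5) =
    ∑' k : ℕ, ENNReal.ofReal (poch d k / (Nat.factorial k : ℝ)) * (pp (-d - k) (y1 - y5) *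
      ENNReal.ofReal (beta (1 - d + k) 1)) * (pp (1 - 2 * d + k) (y1 - y3) * pp (1 - 2 * d) (y3 - y5)) := by
    intro y3
    rw [inner_y2 d h0 h1, ← ENNReal.tsum_mul_left]
    congr 1; ext k
    rw [show 1 - 2 * d + (k:ℝ) = -d + (1 - d + k) by ring, ← pp_mul (-d) (1 - d + k)]
    ring
  simp_rw [this]
  rw [lintegral_tsum (fun k => by fun_prop), ← ENNReal.tsum_mul_right]
  congr 1; ext k
  rw [lintegral_const_mul _ (by fun_prop), conv _ _ _ _ (by
    have : (0:ℝ) ≤ k := by positivity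
    linarith) (by linarith)]
  rw [show 1 - 2 * d + (k:ℝ) + 1 = 2 - 2 * d + k by ring, show 1 - 2 * d + 1 = 2 - 2 * d by ring,
    show (3 - 5 * d) = (-d - k) + (1 - 2 * d + (k:ℝ) + (1 - 2 * d) + 1) by ring, ← pp_mul (-d - k)]
  ring

open ProbabilityTheory in
lemma total (d : ℝ) (h0 : 0 ≤ d) (h1 : d < 1/2) :
    ∫⁻ y1, ∫⁻ y2, ∫⁻ y3, ∫⁻ y4, ∫⁻ y5, FF d y1 y2 y3 y4 y5 =
    ENNReal.ofReal (beta (1 - d) (1 - d)) * (∑' k : ℕ, ENNReal.ofReal (poch d k / (Nat.factorial k : ℝ)) *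
      (ENNReal.ofReal (beta (1 - d + k) 1) * ENNReal.ofReal (beta (2 - 2 * d + k) (2 - 2 * d)))) *
      (ENNReal.ofReal (beta 1 (4 - 5 * d)) * ENNReal.ofReal (beta (5 - 5 * d) 1)) := by
  set B := ENNReal.ofReal (beta (1 - d) (1 - d)) with hB
  set S := ∑' k : ℕ, ENNReal.ofReal (poch d k / (Nat.factorial k : ℝ)) *
      (ENNReal.ofReal (beta (1 - d + k) 1) * ENNReal.ofReal (beta (2 - 2 * d + k) (2 - 2 * d))) with hS
  have e1 : ∀ y1 y2 y3, ∫⁻ y4, ∫⁻ y5, FF d y1 y2 y3 y4 y5 =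
      ∫⁻ y5, (B * pp 0 (1 - y1) * pp 0 y5) * (pp (-d) (y1 - y3) *
        (pp (-d) (y1 - y2) * pp 0 (y2 - y3) * pp (-d) (y2 - y5) * pp (1 - 2 * d) (y3 - y5))) := by
    intro y1 y2 y3
    rw [lintegral_lintegral_swap (by unfold FF; simp only [Function.uncurry_def]; fun_prop)]
    congr 1; ext y5
    have : ∀ y4, FF d y1 y2 y3 y4 y5 = (pp 0 (1 - y1) * pp 0 y5 * pp (-d) (y1 - y3) *
        (pp (-d) (y1 - y2) * pp 0 (y2 - y3) * pp (-d) (y2 - y5))) *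
        (pp (-d) (y3 - y4) * pp (-d) (y4 - y5)) := by
      intro y4; unfold FF; ring
    simp_rw [this]
    rw [lintegral_const_mul _ (by fun_prop), conv _ _ _ _ (by linarith) (by linarith),
      show -d + 1 = 1 - d by ring, show -d + -d + 1 = 1 - 2 * d by ring, ← hB]
    ring
  simp_rw [e1]
  have e2 : ∀ y1, ∫⁻ y2, ∫⁻ y3, ∫⁻ y5, (B * pp 0 (1 - y1) * pp 0 y5) * (pp (-d) (y1 - y3) *
        (pp (-d) (y1 - y2) * pp 0 (y2 - y3) * pp (-d) (y2 - y5) * pp (1 - 2 * d) (y3 - y5))) =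
      ∫⁻ y5, (B * S * pp 0 (1 - y1) * pp 0 y5) * pp (3 - 5 * d) (y1 - y5) := by
    intro y1
    have s1 : ∀ y2, ∫⁻ y3, ∫⁻ y5, (B * pp 0 (1 - y1) * pp 0 y5) * (pp (-d) (y1 - y3) *
        (pp (-d) (y1 - y2) * pp 0 (y2 - y3) * pp (-d) (y2 - y5) * pp (1 - 2 * d) (y3 - y5))) =
       ∫⁻ y5, ∫⁻ y3, (B * pp 0 (1 - y1) * pp 0 y5) * (pp (-d) (y1 - y3) *
        (pp (-d) (y1 - y2) * pp 0 (y2 - y3) * pp (-d) (y2 - y5) * pp (1 - 2 * d) (y3 - y5))) := by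
      intro y2
      exact lintegral_lintegral_swap (by simp only [Function.uncurry_def]; fun_prop)
    simp_rw [s1]
    rw [lintegral_lintegral_swap (by
      simp only [Function.uncurry_def]; apply Measurable.aemeasurable; apply ml; fun_prop)]
    congr 1; ext y5
    rw [lintegral_lintegral_swap (by simp only [Function.uncurry_def]; fun_prop)]
    have s2 : ∀ y3, ∫⁻ y2, (B * pp 0 (1 - y1) * pp 0 y5) * (pp (-d) (y1 - y3) *
        (pp (-d) (y1 - y2) * pp 0 (y2 - y3) * pp (-d) (y2 - y5) * pp (1 - 2 * d) (y3 - y5))) =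
       (B * pp 0 (1 - y1) * pp 0 y5) * (pp (-d) (y1 - y3) * ∫⁻ y2,
        (pp (-d) (y1 - y2) * pp 0 (y2 - y3) * pp (-d) (y2 - y5) * pp (1 - 2 * d) (y3 - y5))) := by
      intro y3
      rw [lintegral_const_mul _ (by fun_prop), lintegral_const_mul _ (by fun_prop)]
    simp_rw [s2]
    rw [lintegral_const_mul, inner_y3 d h0 h1]
    · ring
    · apply Measurable.mul (by fun_prop)
      apply ml; fun_prop
  simp_rw [e2]
  rw [lintegral_lintegral_swap (by simp only [Function.uncurry_def]; fun_prop)]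
  have e3 : ∀ y5, ∫⁻ y1, (B * S * pp 0 (1 - y1) * pp 0 y5) * pp (3 - 5 * d) (y1 - y5) =
      (B * S * ENNReal.ofReal (beta 1 (4 - 5 * d))) * (pp (4 - 5 * d) (1 - y5) * pp 0 (y5 - 0)) := by
    intro y5
    have : ∀ y1, (B * S * pp 0 (1 - y1) * pp 0 y5) * pp (3 - 5 * d) (y1 - y5) =
      (B * S * pp 0 y5) * (pp 0 (1 - y1) * pp (3 - 5 * d) (y1 - y5)) := fun y1 => by ring
    simp_rw [this]
    rw [lintegral_const_mul _ (by fun_prop), conv _ _ _ _ (by norm_num) (by linarith),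
      show 3 - 5 * d + 1 = 4 - 5 * d by ring, show 0 + (3 - 5 * d) + 1 = 4 - 5 * d by ring, zero_add, sub_zero]
    ring
  simp_rw [e3]
  rw [lintegral_const_mul _ (by fun_prop), conv _ _ _ _ (by linarith) (by norm_num),
    show 4 - 5 * d + 1 = 5 - 5 * d by ring, zero_add, sub_zero, pp_pos one_pos, Real.one_rpow]
  simp only [ENNReal.ofReal_one]
  ring

lemma pq (a : ℝ) (k : ℕ) : poch a k * (a + k) = a * poch (a + 1) k := by
  induction k with
  | zero => simp [poch]
  | succ n ih => rw [poch_succ, poch_succ, ih]; push_cast; ring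

noncomputable def uu (d : ℝ) (k : ℕ) : ℝ :=
  poch d k * poch (1-d) k * poch (2-2*d) k / (poch (2-d) k * poch (4-4*d) k * (Nat.factorial k : ℝ))

lemma uu_nonneg (d : ℝ) (h0 : 0 ≤ d) (h1 : d < 1/2) (k : ℕ) : 0 ≤ uu d k := by
  have a1 := poch_nonneg h0 k
  have a2 := poch_nonneg (show 0 ≤ 1 - d by linarith) k
  have a3 := poch_nonneg (show 0 ≤ 2 - 2 * d by linarith) k
  have a4 := poch_nonneg (show 0 ≤ 2 - d by linarith) k
  have a5 := poch_nonneg (show 0 ≤ 4 - 4 * d by linarith) k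
  unfold uu; positivity

lemma poch_mono {a b : ℝ} (ha : 0 ≤ a) (h : a ≤ b) (k : ℕ) : poch a k ≤ poch b k :=
  Finset.prod_le_prod (fun i _ => by positivity) (fun i _ => by linarith)

lemma poch_one (k : ℕ) : poch 1 k = (Nat.factorial k : ℝ) := by
  induction k with
  | zero => simp [poch]
  | succ n ih => rw [poch_succ, ih, Nat.factorial_succ]; push_cast; ring

lemma summ (d : ℝ) (h0 : 0 ≤ d) (h1 : d < 1/2) : Summable (uu d) := by
  have hs : Summable (fun k : ℕ => 4 * (1 / ((k + 1 : ℕ) : ℝ) ^ 2)) :=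
    ((summable_nat_add_iff 1).2 (Real.summable_one_div_nat_pow.2 one_lt_two)).mul_left 4
  refine Summable.of_nonneg_of_le (uu_nonneg d h0 h1) (fun k => ?_) hs
  have hk : (0:ℝ) ≤ k := by positivity
  have f := poch_mono h0 (show d ≤ 1 by linarith) k
  rw [poch_one] at f
  have q1 := pq (1 - d) k
  have q2 := pq (2 - 2 * d) k
  have m := poch_mono (show 0 ≤ 2 - 2 * d + 1 by linarith) (show 2 - 2 * d + 1 ≤ 4 - 4 * d by linarith) k
  have a1 := poch_nonneg h0 k
  have a2 := poch_nonneg (show 0 ≤ 1 - d by linarith) k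
  have a3 := poch_nonneg (show 0 ≤ 2 - 2 * d by linarith) k
  have a4 := poch_pos (show 0 < 2 - d by linarith) k
  have a5 := poch_pos (show 0 < 4 - 4 * d by linarith) k
  have a6 : (0:ℝ) < (Nat.factorial k : ℝ) := by positivity
  rw [show 1 - d + 1 = 2 - d by ring] at q1
  have r1 : poch (1 - d) k / poch (2 - d) k ≤ 2 / (k + 1) := by
    rw [div_le_div_iff₀ a4 (by positivity)]
    nlinarith [mul_nonneg a2 hk]
  have r2 : poch (2 - 2 * d) k / poch (4 - 4 * d) k ≤ 2 / (k + 1) := by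
    rw [div_le_div_iff₀ a5 (by positivity)]
    nlinarith [mul_nonneg a3 hk]
  have r3 : poch d k / (Nat.factorial k : ℝ) ≤ 1 := by rw [div_le_one a6]; exact f
  calc uu d k = (poch d k / (Nat.factorial k : ℝ)) * ((poch (1 - d) k / poch (2 - d) k) *
        (poch (2 - 2 * d) k / poch (4 - 4 * d) k)) := by unfold uu; field_simp
    _ ≤ 1 * ((2 / (k + 1)) * (2 / (k + 1))) := by gcongr
    _ = _ := by push_cast; field_simp; norm_num

open ProbabilityTheory in
lemma term_eq (d : ℝ) (h0 : 0 ≤ d) (h1 : d < 1/2) (k : ℕ) :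
    ENNReal.ofReal (poch d k / (Nat.factorial k : ℝ)) *
      (ENNReal.ofReal (beta (1 - d + k) 1) * ENNReal.ofReal (beta (2 - 2 * d + k) (2 - 2 * d))) =
    ENNReal.ofReal (Gamma (2 - 2 * d) ^ 2 / ((1 - d) * Gamma (4 - 4 * d)) * uu d k) := by
  have hk : (0:ℝ) ≤ k := by positivity
  have a1 := poch_nonneg h0 k
  have a2 := poch_pos (show 0 < 1 - d by linarith) k
  have a4 := poch_pos (show 0 < 2 - d by linarith) k
  have a5 := poch_pos (show 0 < 4 - 4 * d by linarith) k
  have b1 := beta_pos (show 0 < 1 - d + k by linarith) one_pos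
  have hz1 : 0 < 1 - d := by linarith
  have hz2 : 0 < 1 - d + k := by linarith
  have hG1 := Real.Gamma_pos_of_pos hz1
  have hG3 := Real.Gamma_pos_of_pos (show 0 < 4 - 4 * d by linarith)
  have q1 := pq (1 - d) k
  rw [show 1 - d + 1 = 2 - d by ring] at q1
  rw [← ENNReal.ofReal_mul b1.le, ← ENNReal.ofReal_mul (by positivity)]
  congr 1
  simp only [beta, Real.Gamma_one, uu]
  rw [Real.Gamma_add_one hz2.ne', show 2 - 2 * d + (k:ℝ) + (2 - 2 * d) = 4 - 4 * d + k by ring,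
    Gpoch hz1, Gpoch (a := 2 - 2 * d) (by linarith), Gpoch (a := 4 - 4 * d) (by linarith)]
  have q2 : poch (2 - d) k = poch (1 - d) k * (1 - d + k) / (1 - d) := by rw [q1]; field_simp
  rw [q2]
  field_simp

theorem stmt14 (d : ℝ) (h0 : 0 ≤ d) (h1 : d < 1/2) :
    (∫ y1 in (0:ℝ)..1, ∫ y2 in (0:ℝ)..y1, ∫ y3 in (0:ℝ)..y2, ∫ y4 in (0:ℝ)..y3, ∫ y5 in (0:ℝ)..y4,
      (y1 - y2) ^ (-d) * (y1 - y3) ^ (-d) * (y3 - y4) ^ (-d) * (y2 - y5) ^ (-d) * (y4 - y5) ^ (-d)) =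
    Gamma (1-d) ^ 2 / (1-d) * (Gamma (4-5*d) * Gamma (2-2*d) / (Gamma (6-5*d) * Gamma (4-4*d))) *
      F32 d (1-d) (2-2*d) (2-d) (4-4*d) := by
  have hz1 : 0 < 1 - d := by linarith
  have hG1 := Real.Gamma_pos_of_pos hz1
  have hG2 := Real.Gamma_pos_of_pos (show 0 < 2 - 2 * d by linarith)
  have hG3 := Real.Gamma_pos_of_pos (show 0 < 4 - 4 * d by linarith)
  have hu := summ d h0 h1
  have hC : 0 ≤ Gamma (2 - 2 * d) ^ 2 / ((1 - d) * Gamma (4 - 4 * d)) := by positivity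
  have htot := total d h0 h1
  simp_rw [fun k => term_eq d h0 h1 k] at htot
  rw [← ENNReal.ofReal_tsum_of_nonneg (fun k => mul_nonneg hC (uu_nonneg d h0 h1 k)) (hu.mul_left _),
    tsum_mul_left] at htot
  have b1 := ProbabilityTheory.beta_pos hz1 hz1
  have b2 := ProbabilityTheory.beta_pos one_pos (show 0 < 4 - 5 * d by linarith)
  have b3 := ProbabilityTheory.beta_pos (show 0 < 5 - 5 * d by linarith) one_pos
  rw [real_side d (by rw [htot]; finiteness), htot]
  simp only [ENNReal.toReal_mul]
  rw [ENNReal.toReal_ofReal b1.le, ENNReal.toReal_ofReal b2.le, ENNReal.toReal_ofReal b3.le,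
    ENNReal.toReal_ofReal (mul_nonneg hC (tsum_nonneg (uu_nonneg d h0 h1)))]
  change _ * (_ * F32 d (1-d) (2-2*d) (2-d) (4-4*d)) * _ = _
  have g4 := Real.Gamma_pos_of_pos (show 0 < 4 - 5 * d by linarith)
  have e5 : Gamma (5 - 5 * d) = (4 - 5 * d) * Gamma (4 - 5 * d) := by
    rw [← Real.Gamma_add_one (by linarith)]; ring_nf
  have e6 : Gamma (6 - 5 * d) = (5 - 5 * d) * Gamma (5 - 5 * d) := by
    rw [← Real.Gamma_add_one (by linarith)]; ring_nf
  have p4 : 0 < 4 - 5 * d := by linarith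
  have p5 : 0 < 5 - 5 * d := by linarith
  simp only [ProbabilityTheory.beta, Real.Gamma_one]
  rw [show 1 - d + (1 - d) = 2 - 2 * d by ring, show 1 + (4 - 5 * d) = 5 - 5 * d by ring,
    show 5 - 5 * d + 1 = 6 - 5 * d by ring, e6, e5]
  generalize F32 d (1-d) (2-2*d) (2-d) (4-4*d) = X
  field_simp
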